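/- Let C be an information-lossless pushdown compressor over the binary alphabet, working with an endmarker. Then ρ_C(0^∞) > 0, i.e., liminf_{n→∞} |C(0ⁿ#)|/n > 0. -/

import Mathlib

/-- A pushdown transducer with input alphabet `In`, output alphabet `Out`,
stack alphabet `Γ` and state set `Q`.  A transition `δ q none z` is a
`λ`-rule (no input symbol is read); `det` is the determinism requirement that
for every state and top stack symbol, either the `λ`-rule or all the reading
rules are undefined; `bottom` requires that the bottom-of-stack symbol `z₀`
is never removed from the bottom of the stack. -/
structure PDT (In Out Γ Q : Type*) where
  δ : Q → Option In → Γ → Option (Q × List Γ)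
  ν : Q → Option In → Γ → List Out
  q₀ : Q
  z₀ : Γ
  det : ∀ q z, δ q none z = none ∨ ∀ b, δ q (some b) z = none
  bottom : ∀ q b p, δ q b z₀ = some p → ∃ q' v, p = (q', v ++ [z₀])

namespace PDT

variable {In Out Γ Q : Type*}

/-- Instantaneous description: current state, stack (top first), remaining
input, and output produced so far. -/
abbrev ID (In Out Γ Q : Type*) := Q × List Γ × List In × List Out

/-- One computation step of a pushdown transducer: either a `λ`-rule, or the
reading of one input symbol; in both cases the top stack symbol is replaced
by a (possibly empty) word and the corresponding output is appended. -/
inductive Step (M : PDT In Out Γ Q) : ID In Out Γ Q → ID In Out Γ Q → Prop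
  | lam {q z s inp out q' v} : M.δ q none z = some (q', v) →
      Step M (q, z :: s, inp, out) (q', v ++ s, inp, out ++ M.ν q none z)
  | read {q z s b inp out q' v} : M.δ q (some b) z = some (q', v) →
      Step M (q, z :: s, b :: inp, out) (q', v ++ s, inp, out ++ M.ν q (some b) z)

/-- An ID is terminal when the input has been entirely read and no `λ`-rule
is enabled. -/
def Terminal (M : PDT In Out Γ Q) : ID In Out Γ Q → Prop
  | (q, s, inp, _) => inp = [] ∧ ∀ z s', s = z :: s' → M.δ q none z = none

/-- `M.Computes w qf o`: the complete run of `M` on input `w` ends in state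
`qf` having produced the total output `o`. -/
def Computes (M : PDT In Out Γ Q) (w : List In) (qf : Q) (o : List Out) : Prop :=
  ∃ s, Relation.ReflTransGen (Step M) (M.q₀, [M.z₀], w, []) (qf, s, [], o) ∧
    Terminal M (qf, s, [], o)

end PDT

/-- A pushdown compressor (working without endmarker) over the alphabet `A`:
a pushdown transducer with input and output alphabet `A` whose computation
terminates on every input, hence computing a total function. -/
structure PDC (A Γ Q : Type*) extends PDT A A Γ Q where
  total : ∀ w : List A, ∃ qf o, toPDT.Computes w qf o

namespace PDC
variable {A Γ Q : Type*}

/-- The state `δ_Q(w)` reached by the compressor after processing `w`. -/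
noncomputable def finalState (M : PDC A Γ Q) (w : List A) : Q := (M.total w).choose

/-- `M.output w` is `C(w)`, the output of the compressor on input `w`. -/
noncomputable def output (M : PDC A Γ Q) (w : List A) : List A :=
  (M.total w).choose_spec.choose

/-- Information-losslessness: the map `w ↦ (C(w), δ_Q(w))` is injective. -/
def IL (M : PDC A Γ Q) : Prop :=
  Function.Injective fun w => (M.output w, M.finalState w)


end PDC

/-- The input word followed by the endmarker `#` (modelled as `none`). -/
def endmark {A : Type*} (w : List A) : List (Option A) := w.map some ++ [none]

/-- A pushdown compressor working with an endmarker, over the alphabet `A`: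
a pushdown transducer whose input alphabet is `Option A`, where `none` plays
the role of the endmarker `#` (so that `λ`-rules may keep popping the stack
and producing output after the endmarker has been read), and whose
computation on `w#` terminates for every word `w`. -/
structure PDCE (A Γ Q : Type*) extends PDT (Option A) A Γ Q where
  total : ∀ w : List A, ∃ qf o, toPDT.Computes (endmark w) qf o

namespace PDCE
variable {A Γ Q : Type*}

/-- The final state reached by the compressor on input `w#`. -/
noncomputable def finalState (M : PDCE A Γ Q) (w : List A) : Q := (M.total w).choose

/-- `M.output w` is `C(w#)`, the total output of the compressor on `w#`. -/
noncomputable def output (M : PDCE A Γ Q) (w : List A) : List A :=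
  (M.total w).choose_spec.choose

/-- Information-losslessness: the map `w ↦ (C(w#), final state)` is injective. -/
def IL (M : PDCE A Γ Q) : Prop :=
  Function.Injective fun w => (M.output w, M.finalState w)

end PDCE

/-! ### Pumping for stack-emptying derivations -/

/-- `Pops R p s t n p'`: starting in state `p`, the rules `R` pop the word `s` off the stack in `n`
rule applications, ending in state `p'` and emitting the trace `t`. A rule `R p z t p' v` replaces
the top symbol `z` by `v`, moves from `p` to `p'` and emits `t`. -/
inductive Pops {P Γ E : Type*} (R : P → Γ → List E → P → List Γ → Prop) :
    P → List Γ → List E → ℕ → P → Prop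
  | nil (p) : Pops R p [] [] 0 p
  | cons {p z t₀ p₁ v t₁ n₁ p₂ s t₂ n₂ p₃} : R p z t₀ p₁ v → Pops R p₁ v t₁ n₁ p₂ →
      Pops R p₂ s t₂ n₂ p₃ → Pops R p (z :: s) (t₀ ++ t₁ ++ t₂) (1 + n₁ + n₂) p₃

namespace Pops

variable {P Γ E : Type*} {R : P → Γ → List E → P → List Γ → Prop}

theorem append {p s t n p' s' t' n' p''} (h : Pops R p s t n p') (h' : Pops R p' s' t' n' p'') :
    Pops R p (s ++ s') (t ++ t') (n + n') p'' := by
  induction h with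
  | nil p => simpa using h'
  | cons hR h₁ _ _ ih₂ =>
    have := Pops.cons hR h₁ (ih₂ h')
    simpa [List.append_assoc, add_assoc] using this

theorem split {s s' : List Γ} {p t n p''} (h : Pops R p (s ++ s') t n p'') :
    ∃ t₁ n₁ p' t₂ n₂, Pops R p s t₁ n₁ p' ∧ Pops R p' s' t₂ n₂ p'' ∧ t = t₁ ++ t₂ := by
  induction s generalizing p t n with
  | nil => exact ⟨[], 0, p, t, n, .nil p, h, rfl⟩
  | cons z s ih =>
    cases h with
    | cons hR h₁ h₂ =>
      obtain ⟨t₁, n₁, p', t₂, n₂, ha, hb, rfl⟩ := ih h₂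
      exact ⟨_, _, p', t₂, n₂, .cons hR h₁ ha, hb, by simp⟩

theorem singleton {p z t₀ p₁ v t₁ n₁ p₂} (hR : R p z t₀ p₁ v) (h : Pops R p₁ v t₁ n₁ p₂) :
    Pops R p [z] (t₀ ++ t₁) (1 + n₁) p₂ := by
  simpa using Pops.cons hR h (.nil p₂)

theorem length_trace_le {c : ℕ} (hc : ∀ p z t p' v, R p z t p' v → t.length ≤ c)
    {p s t n p'} (h : Pops R p s t n p') : t.length ≤ c * n := by
  induction h with
  | nil p => simp
  | cons hR _ _ ih₁ ih₂ =>
    have := hc _ _ _ _ _ hR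
    simp only [List.length_append]
    linarith

/-- A derivation is irreducible if deleting parts of its trace outside of the events selected by
`keep` never leads to a shorter derivation. -/
def Irreducible (R : P → Γ → List E → P → List Γ → Prop) (keep : E → Bool)
    (p : P) (s : List Γ) (t : List E) (n : ℕ) (p' : P) : Prop :=
  ∀ t' n', Pops R p s t' n' p' → t'.Sublist t → t'.filter keep = t.filter keep → n ≤ n'

/-- The trace `t` of a derivation of length `n` contains a derivation of one of the
goals in `S`, outside of which no event selected by `keep` occurs. -/
def Meets (R : P → Γ → List E → P → List Γ → Prop) (keep : E → Bool)
    (S : Finset (P × Γ × P)) (t : List E) (n : ℕ) : Prop :=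
  ∃ B ∈ S, ∃ t' n', Pops R B.1 [B.2.1] t' n' B.2.2 ∧ n' ≤ n ∧ t'.Sublist t ∧
    t'.filter keep = t.filter keep

theorem not_meets_empty {keep : E → Bool} {t : List E} {n : ℕ} : ¬ Meets R keep ∅ t n := by
  simp [Meets]

theorem Meets.mono {keep : E → Bool} {S : Finset (P × Γ × P)} {t u : List E} {n m : ℕ}
    (h : Meets R keep S t n) (hnm : n ≤ m) (htu : t.Sublist u)
    (hk : t.filter keep = u.filter keep) : Meets R keep S u m := by
  obtain ⟨B, hB, t', n', h', hn, ht, hk'⟩ := h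
  exact ⟨B, hB, t', n', h', hn.trans hnm, ht.trans htu, hk'.trans hk⟩

theorem Irreducible.child {keep : E → Bool} {p z t₀ p₁ v t₁ n₁ p₂ s t₂ n₂ p₃}
    (hI : Irreducible R keep p (z :: s) (t₀ ++ t₁ ++ t₂) (1 + n₁ + n₂) p₃)
    (hR : R p z t₀ p₁ v) (h₂ : Pops R p₂ s t₂ n₂ p₃) :
    Irreducible R keep p₁ v t₁ n₁ p₂ := by
  intro t' n' h' ht hk
  have := hI _ _ (.cons hR h' h₂) (((List.Sublist.refl _).append ht).append (.refl _))
    (by simp [hk])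
  omega

theorem Irreducible.tail {keep : E → Bool} {p z t₁ n₁ p₂ s t₂ n₂ p₃}
    (hI : Irreducible R keep p (z :: s) (t₁ ++ t₂) (n₁ + n₂) p₃)
    (h₁ : Pops R p [z] t₁ n₁ p₂) :
    Irreducible R keep p₂ s t₂ n₂ p₃ := by
  intro t' n' h' ht hk
  have := hI _ _ (h₁.append h') ((List.Sublist.refl _).append ht) (by simp [hk])
  omega

theorem Irreducible.head {keep : E → Bool} {p z t₁ n₁ p₂ s t₂ n₂ p₃}
    (hI : Irreducible R keep p (z :: s) (t₁ ++ t₂) (n₁ + n₂) p₃)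
    (h₂ : Pops R p₂ s t₂ n₂ p₃) :
    Irreducible R keep p [z] t₁ n₁ p₂ := by
  intro t' n' h' ht hk
  have := hI _ _ (h'.append h₂) (ht.append (.refl _)) (by simp [hk])
  omega

/-- In an irreducible derivation, a goal cannot recur below itself with no kept event between. -/
theorem Irreducible.meets_of_insert [DecidableEq (P × Γ × P)] {keep : E → Bool}
    {S : Finset (P × Γ × P)} {p z t₀ t₁ n₁ p₂}
    (hI : Irreducible R keep p [z] (t₀ ++ t₁) (1 + n₁) p₂) (hk₀ : t₀.filter keep = [])
    (h : Meets R keep (insert (p, z, p₂) S) t₁ n₁) : Meets R keep S t₁ n₁ := by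
  obtain ⟨B, hB, t', n', h', hn, ht, hk⟩ := h
  rcases Finset.mem_insert.1 hB with rfl | hB
  · have := hI t' n' h' (ht.trans (List.sublist_append_right _ _)) (by simp [hk, hk₀])
    omega
  · exact ⟨B, hB, t', n', h', hn, ht, hk⟩

/-- The number of nodes of an `L`-ary tree of depth less than `k`, used as a bound. -/
def treeSize (L : ℕ) : ℕ → ℕ
  | 0 => 0
  | k + 1 => 1 + L * treeSize L k

variable [Fintype P] [Fintype Γ]

theorem length_le_of_filter_eq_nil {L : ℕ} (hL : ∀ p z t p' v, R p z t p' v → v.length ≤ L)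
    {keep : E → Bool} {p s t n p'} (h : Pops R p s t n p')
    (hI : Irreducible R keep p s t n p') (hk : t.filter keep = []) (S : Finset (P × Γ × P)) :
    Meets R keep S t n ∨
      n ≤ s.length * treeSize L (Fintype.card (P × Γ × P) - S.card) := by
  classical
  induction h generalizing S with
  | nil p => simp
  | @cons p z t₀ p₁ v t₁ n₁ p₂ s t₂ n₂ p₃ hR h₁ h₂ ih₁ ih₂ =>
    have hz := singleton hR h₁
    simp only [List.filter_append, List.append_eq_nil_iff] at hk
    obtain ⟨⟨hk₀, hk₁⟩, hk₂⟩ := hk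
    by_cases hA : (p, z, p₂) ∈ S
    · exact .inl ⟨_, hA, _, _, hz, by omega, List.sublist_append_left _ _,
        by simp [hk₀, hk₁, hk₂]⟩
    rcases ih₂ (hI.tail hz) hk₂ S with hM | hb₂
    · exact .inl (hM.mono (by omega) (List.sublist_append_right _ _) (by simp [hk₀, hk₁]))
    rcases ih₁ (hI.child hR h₂) hk₁ (insert (p, z, p₂) S) with hM | hb₁
    · refine .inl (((hI.head h₂).meets_of_insert hk₀ hM).mono (by omega) ?_ ?_)
      · exact (List.sublist_append_right t₀ t₁).trans (List.sublist_append_left _ _)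
      · simp [hk₀, hk₂]
    · right
      have hcard := Finset.card_le_univ (insert (p, z, p₂) S)
      rw [Finset.card_insert_of_notMem hA] at hb₁ hcard
      obtain ⟨k, hk⟩ : ∃ k, Fintype.card (P × Γ × P) - S.card = k + 1 :=
        ⟨Fintype.card (P × Γ × P) - (S.card + 1), by omega⟩
      rw [show Fintype.card (P × Γ × P) - (S.card + 1) = k by omega] at hb₁
      rw [hk] at hb₂ ⊢
      have := Nat.mul_le_mul_right (treeSize L k) (hL _ _ _ _ _ hR)
      have : 1 + n₁ ≤ treeSize L (k + 1) := by rw [treeSize]; omega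
      rw [List.length_cons, Nat.succ_mul]
      omega

theorem length_le_of_filter_ne_nil {L : ℕ} (hL : ∀ p z t p' v, R p z t p' v → v.length ≤ L)
    {N a D K : ℕ} (hN : N = Fintype.card (P × Γ × P)) (ha : a = treeSize L N)
    (hD : D = 1 + L * a) (hK : K = (N + 1) * D)
    {keep : E → Bool} {p s t n p'} (h : Pops R p s t n p')
    (hI : Irreducible R keep p s t n p') (hk : t.filter keep ≠ []) (S : Finset (P × Γ × P)) :
    Meets R keep S t n ∨
      n + S.card * D + K ≤ s.length * a + 2 * (t.filter keep).length * K := by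
  classical
  induction h generalizing S with
  | nil p => simp at hk
  | @cons p z t₀ p₁ v t₁ n₁ p₂ s t₂ n₂ p₃ hR h₁ h₂ ih₁ ih₂ =>
    have hz := singleton hR h₁
    have hI₁ := hI.child hR h₂
    have hI₂ := hI.tail hz
    have hSD : S.card * D + D ≤ K := by
      rw [hK, Nat.succ_mul, hN]
      gcongr
      exact Finset.card_le_univ S
    have hva : 1 + v.length * a ≤ D := by
      have := Nat.mul_le_mul_right a (hL _ _ _ _ _ hR)
      omega
    have unkept {p s t n p'} (h : Pops R p s t n p') (hI : Irreducible R keep p s t n p')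
        (hk : t.filter keep = []) : n ≤ s.length * a := by
      have := (length_le_of_filter_eq_nil hL h hI hk ∅).resolve_left not_meets_empty
      simpa [ha, hN] using this
    have kept₁ (hk : t₁.filter keep ≠ []) := (ih₁ hI₁ hk ∅).resolve_left not_meets_empty
    have kept₂ (hk : t₂.filter keep ≠ []) := (ih₂ hI₂ hk ∅).resolve_left not_meets_empty
    simp only [Finset.card_empty, zero_mul, add_zero] at kept₁ kept₂
    simp only [List.filter_append, List.length_append, List.length_cons, add_mul, mul_add,
      one_mul] at hk ⊢
    by_cases hk₀ : t₀.filter keep = []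
    swap
    · right
      have hpos : K ≤ (t₀.filter keep).length * K :=
        Nat.le_mul_of_pos_left _ (List.length_pos_of_ne_nil hk₀)
      have b₁ : n₁ ≤ v.length * a + 2 * (t₁.filter keep).length * K := by
        by_cases hk₁ : t₁.filter keep = []
        · have := unkept h₁ hI₁ hk₁
          omega
        · have := kept₁ hk₁
          omega
      have b₂ : n₂ ≤ s.length * a + 2 * (t₂.filter keep).length * K := by
        by_cases hk₂ : t₂.filter keep = []
        · have := unkept h₂ hI₂ hk₂
          omega
        · have := kept₂ hk₂
          omega
      linarith
    by_cases hk₁ : t₁.filter keep = []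
    · have hk₂ : t₂.filter keep ≠ [] := by simpa [hk₀, hk₁] using hk
      rcases ih₂ hI₂ hk₂ S with hM | hb₂
      · exact .inl (hM.mono (by omega) (List.sublist_append_right _ _) (by simp [hk₀, hk₁]))
      · have := unkept hz (hI.head h₂) (by simp [hk₀, hk₁])
        simp only [List.length_singleton, one_mul] at this
        simp only [hk₀, hk₁, List.length_nil, mul_zero, zero_mul, zero_add]
        right
        omega
    by_cases hk₂ : t₂.filter keep = []
    · by_cases hA : (p, z, p₂) ∈ S
      · exact .inl ⟨_, hA, _, _, hz, by omega, List.sublist_append_left _ _, by simp [hk₂]⟩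
      rcases ih₁ hI₁ hk₁ (insert (p, z, p₂) S) with hM | hb₁
      · refine .inl (((hI.head h₂).meets_of_insert hk₀ hM).mono (by omega) ?_ ?_)
        · exact (List.sublist_append_right t₀ t₁).trans (List.sublist_append_left _ _)
        · simp [hk₀, hk₂]
      · rw [Finset.card_insert_of_notMem hA, Nat.succ_mul] at hb₁
        have := unkept h₂ hI₂ hk₂
        simp only [hk₀, hk₂, List.length_nil, mul_zero, zero_mul, zero_add]
        right
        omega
    · have := kept₁ hk₁
      have := kept₂ hk₂
      simp only [hk₀, List.length_nil, mul_zero, zero_mul, zero_add]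
      right
      omega

/-- An irreducible derivation is at most linearly long in the number of kept events. -/
theorem exists_length_le {L : ℕ} (hL : ∀ p z t p' v, R p z t p' v → v.length ≤ L) :
    ∃ c : ℕ, ∀ (keep : E → Bool) p z t n p', Pops R p [z] t n p' →
      Irreducible R keep p [z] t n p' → n ≤ c * ((t.filter keep).length + 1) := by
  set N := Fintype.card (P × Γ × P) with hN
  set a := treeSize L N with ha
  set D := 1 + L * a with hD
  set K := (N + 1) * D with hK
  refine ⟨a + 2 * K, fun keep p z t n p' h hI => ?_⟩
  by_cases hk : t.filter keep = []
  · have := (length_le_of_filter_eq_nil hL h hI hk ∅).resolve_left not_meets_empty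
    simp only [List.length_singleton, one_mul, Finset.card_empty, Nat.sub_zero, ← hN,
      ← ha] at this
    simp only [hk, List.length_nil]
    omega
  · have := (length_le_of_filter_ne_nil hL hN ha hD hK h hI hk ∅).resolve_left not_meets_empty
    simp only [List.length_singleton, one_mul, Finset.card_empty, zero_mul] at this
    nlinarith [Nat.zero_le (a * (t.filter keep).length)]

end Pops

/-! ### Complete runs of a pushdown transducer as derivations -/

namespace PDT

variable {In Out Γ Q : Type*}

/-- The input read along a trace. -/
def reads (t : List (In ⊕ Out)) : List In := t.filterMap Sum.getLeft?

/-- The output written along a trace. -/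
def writes (t : List (In ⊕ Out)) : List Out := t.filterMap Sum.getRight?

@[simp] theorem reads_append (t u : List (In ⊕ Out)) : reads (t ++ u) = reads t ++ reads u :=
  List.filterMap_append

@[simp] theorem writes_append (t u : List (In ⊕ Out)) : writes (t ++ u) = writes t ++ writes u :=
  List.filterMap_append

@[simp] theorem reads_nil : reads ([] : List (In ⊕ Out)) = [] := rfl

@[simp] theorem writes_nil : writes ([] : List (In ⊕ Out)) = [] := rfl

@[simp] theorem reads_inl_cons (i : In) (t : List (In ⊕ Out)) :
    reads (.inl i :: t) = i :: reads t := rfl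

@[simp] theorem reads_inr_cons (o : Out) (t : List (In ⊕ Out)) :
    reads (.inr o :: t) = reads t := rfl

@[simp] theorem writes_inl_cons (i : In) (t : List (In ⊕ Out)) :
    writes (.inl i :: t) = writes t := rfl

@[simp] theorem writes_inr_cons (o : Out) (t : List (In ⊕ Out)) :
    writes (.inr o :: t) = o :: writes t := rfl

/-- The events of a single transition. -/
def events (b : Option In) (o : List Out) : List (In ⊕ Out) :=
  b.toList.map Sum.inl ++ o.map Sum.inr

@[simp] theorem reads_events (b : Option In) (o : List Out) : reads (events b o) = b.toList := by
  induction o <;> cases b <;> simp_all [events]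

@[simp] theorem writes_events (b : Option In) (o : List Out) : writes (events b o) = o := by
  induction o <;> cases b <;> simp_all [events]

/-- The transitions of `M`, on states `Sum.inl q`, together with rules which may halt `M` when no
`λ`-rule is enabled and then empty the stack, remembering the last state `q` as `Sum.inr q`. -/
inductive Rule (M : PDT In Out Γ Q) : Q ⊕ Q → Γ → List (In ⊕ Out) → Q ⊕ Q → List Γ → Prop
  | move {q b z q' v} : M.δ q b z = some (q', v) →
      Rule M (.inl q) z (events b (M.ν q b z)) (.inl q') v
  | halt {q z} : M.δ q none z = none → Rule M (.inl q) z [] (.inr q) []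
  | flush {q z} : Rule M (.inr q) z [] (.inr q) []

theorem pops_flush (M : PDT In Out Γ Q) (q : Q) (s : List Γ) :
    ∃ n, Pops M.Rule (.inr q) s [] n (.inr q) := by
  induction s with
  | nil => exact ⟨0, .nil _⟩
  | cons z s ih =>
    obtain ⟨n, hn⟩ := ih
    exact ⟨_, Pops.cons .flush (.nil _) hn⟩

theorem exists_pops_of_steps {M : PDT In Out Γ Q} {c : ID In Out Γ Q} {qf : Q} {sf : List Γ}
    {o : List Out} (h : Relation.ReflTransGen (Step M) c (qf, sf, [], o))
    (hT : Terminal M (qf, sf, [], o)) :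
    ∃ t n p, Pops M.Rule (.inl c.1) c.2.1 t n p ∧ reads t = c.2.2.1 ∧
      c.2.2.2 ++ writes t = o ∧ p.elim id id = qf := by
  induction h using Relation.ReflTransGen.head_induction_on with
  | refl =>
    cases sf with
    | nil => exact ⟨[], 0, .inl qf, .nil _, rfl, by simp, rfl⟩
    | cons z s =>
      obtain ⟨n, hn⟩ := pops_flush M qf s
      exact ⟨_, _, _, .cons (.halt (hT.2 z s rfl)) (.nil _) hn, rfl, by simp, rfl⟩
  | head hstep _ ih =>
    obtain ⟨t, n, p, h, hr, hw, hp⟩ := ih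
    cases hstep with
    | lam hδ =>
      obtain ⟨t₁, n₁, p', t₂, n₂, h₁, h₂, rfl⟩ := h.split
      refine ⟨_, _, p, .cons (.move hδ) h₁ h₂, ?_, ?_, hp⟩
      · simpa using hr
      · simpa using hw
    | read hδ =>
      obtain ⟨t₁, n₁, p', t₂, n₂, h₁, h₂, rfl⟩ := h.split
      refine ⟨_, _, p, .cons (.move hδ) h₁ h₂, ?_, ?_, hp⟩
      · simpa using hr
      · simpa using hw

theorem eq_of_pops_inr {M : PDT In Out Γ Q} {p p' : Q ⊕ Q} {s t n}
    (h : Pops M.Rule p s t n p') {q : Q} (hp : p = .inr q) : t = [] ∧ p' = .inr q := by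
  induction h with
  | nil => exact ⟨rfl, hp⟩
  | cons hR _ _ ih₁ ih₂ =>
    subst hp
    cases hR
    obtain ⟨rfl, rfl⟩ := ih₁ rfl
    obtain ⟨rfl, rfl⟩ := ih₂ rfl
    exact ⟨rfl, rfl⟩

theorem step_of_rule {M : PDT In Out Γ Q} {q b z q' v} (hδ : M.δ q b z = some (q', v))
    (s : List Γ) (w : List In) (o : List Out) :
    Step M (q, z :: s, b.toList ++ w, o) (q', v ++ s, w, o ++ M.ν q b z) := by
  cases b with
  | none => exact .lam hδ
  | some b => exact .read hδ

theorem steps_of_pops {M : PDT In Out Γ Q} {p p' : Q ⊕ Q} {s t n}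
    (h : Pops M.Rule p s t n p') {q : Q} (hp : p = .inl q) (r : List Γ) (w : List In)
    (o : List Out) :
    ∃ sf, Relation.ReflTransGen (Step M) (q, s ++ r, reads t ++ w, o)
        (p'.elim id id, sf, w, o ++ writes t) ∧
      ((∃ q', p' = .inl q' ∧ sf = r) ∨
        ∃ q' z s', p' = .inr q' ∧ sf = z :: s' ∧ M.δ q' none z = none) := by
  induction h generalizing q r w o with
  | nil =>
    subst hp
    exact ⟨r, by simpa using .refl, .inl ⟨q, rfl, rfl⟩⟩
  | @cons p z t₀ p₁ v t₁ n₁ p₂ s t₂ n₂ p₃ hR h₁ h₂ ih₁ ih₂ =>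
    subst hp
    cases hR with
    | halt hδ =>
      obtain ⟨rfl, rfl⟩ := eq_of_pops_inr h₁ rfl
      obtain ⟨rfl, rfl⟩ := eq_of_pops_inr h₂ rfl
      exact ⟨z :: (s ++ r), by simpa using .refl, .inr ⟨q, z, _, rfl, rfl, hδ⟩⟩
    | @move _ b _ q' _ hδ =>
      have hstep := step_of_rule hδ (s ++ r) (reads t₁ ++ (reads t₂ ++ w)) o
      obtain ⟨sf, hs, hcase⟩ := ih₁ rfl (s ++ r) (reads t₂ ++ w) (o ++ M.ν q b z)
      rcases hcase with ⟨q₂, rfl, rfl⟩ | ⟨q₂, z', s', rfl, rfl, hz'⟩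
      · obtain ⟨sf, hs', hcase⟩ := ih₂ rfl r w (o ++ M.ν q b z ++ writes t₁)
        refine ⟨sf, ?_, hcase⟩
        simpa using (hs.trans hs').head hstep
      · obtain ⟨rfl, rfl⟩ := eq_of_pops_inr h₂ rfl
        refine ⟨z' :: s', ?_, .inr ⟨q₂, z', s', rfl, rfl, hz'⟩⟩
        simpa using hs.head hstep

theorem computes_of_pops {M : PDT In Out Γ Q} {t n p}
    (h : Pops M.Rule (.inl M.q₀) [M.z₀] t n p) :
    M.Computes (reads t) (p.elim id id) (writes t) := by
  obtain ⟨sf, hs, hcase⟩ := steps_of_pops h rfl [] [] []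
  refine ⟨sf, by simpa using hs, rfl, fun z s' hz => ?_⟩
  rcases hcase with ⟨q, rfl, rfl⟩ | ⟨q, z', s'', rfl, rfl, hδ⟩
  · cases hz
  · cases hz
    exact hδ

theorem Computes.exists_pops {M : PDT In Out Γ Q} {w q o} (h : M.Computes w q o) :
    ∃ t n p, Pops M.Rule (.inl M.q₀) [M.z₀] t n p ∧ reads t = w := by
  obtain ⟨s, hs, hT⟩ := h
  obtain ⟨t, n, p, h, hr, -⟩ := exists_pops_of_steps hs hT
  exact ⟨t, n, p, h, hr⟩

theorem Step.rightUnique (M : PDT In Out Γ Q) : Relator.RightUnique (Step M) := by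
  intro c c₁ c₂ h₁ h₂
  cases h₁ with
  | @lam q z _ _ _ _ _ h₁ =>
    cases h₂ with
    | lam h₂ => cases h₁.symm.trans h₂; rfl
    | @read _ _ _ b _ _ _ _ h₂ =>
      rcases M.det q z with h | h
      · simp [h] at h₁
      · simp [h b] at h₂
  | @read q z _ b _ _ _ _ h₁ =>
    cases h₂ with
    | read h₂ => cases h₁.symm.trans h₂; rfl
    | lam h₂ =>
      rcases M.det q z with h | h
      · simp [h] at h₂
      · simp [h b] at h₁

theorem Terminal.not_step {M : PDT In Out Γ Q} {q s o} (h : Terminal M (q, s, [], o))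
    (c : ID In Out Γ Q) : ¬ Step M (q, s, [], o) c := by
  intro hc
  cases hc with
  | lam hδ => simp [h.2 _ _ rfl] at hδ

theorem Terminal.eq_of_steps {M : PDT In Out Γ Q} {q s o} (h : Terminal M (q, s, [], o))
    {c : ID In Out Γ Q} (hc : Relation.ReflTransGen (Step M) (q, s, [], o) c) :
    (q, s, [], o) = c := by
  rcases hc.cases_head with hc | ⟨d, hd, -⟩
  · exact hc
  · exact absurd hd (h.not_step d)

theorem Computes.unique {M : PDT In Out Γ Q} {w q o q' o'} (h : M.Computes w q o)
    (h' : M.Computes w q' o') : q = q' ∧ o = o' := by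
  obtain ⟨s, hs, hT⟩ := h
  obtain ⟨s', hs', hT'⟩ := h'
  rcases Relation.ReflTransGen.total_of_right_unique (Step.rightUnique M) hs hs' with hc | hc
  · cases hT.eq_of_steps hc
    exact ⟨rfl, rfl⟩
  · cases hT'.eq_of_steps hc
    exact ⟨rfl, rfl⟩

theorem exists_rule_bound [Finite In] [Finite Γ] [Finite Q] (M : PDT In Out Γ Q) :
    ∃ L : ℕ, ∀ p z t p' v, M.Rule p z t p' v → t.length ≤ L ∧ v.length ≤ L := by
  let f : Q × Option In × Γ → ℕ := fun x =>
    1 + (M.ν x.1 x.2.1 x.2.2).length + ((M.δ x.1 x.2.1 x.2.2).elim 0 fun y => y.2.length)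
  obtain ⟨L, hL⟩ := (Set.finite_range f).bddAbove
  refine ⟨L, fun p z t p' v h => ?_⟩
  cases h with
  | @move q b _ q' _ hδ =>
    have := hL ⟨(q, b, z), rfl⟩
    simp only [f, hδ, Option.elim_some] at this
    have hb : b.toList.length ≤ 1 := by cases b <;> simp
    simp only [events, List.length_append, List.length_map]
    omega
  | halt => simp
  | flush => simp

theorem reads_filter (t : List (In ⊕ Out)) : reads (t.filter Sum.isLeft) = reads t := by
  induction t with
  | nil => rfl
  | cons e t ih => cases e <;> simp_all [List.filter_cons]

theorem length_filter_isLeft (t : List (In ⊕ Out)) :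
    (t.filter Sum.isLeft).length = (reads t).length := by
  induction t with
  | nil => rfl
  | cons e t ih => cases e <;> simp_all [List.filter_cons]

/-- Selects the output events and the input events satisfying `f`. -/
def keepOn (f : In → Bool) : In ⊕ Out → Bool := Sum.elim f fun _ => true

theorem writes_filter_keepOn (f : In → Bool) (t : List (In ⊕ Out)) :
    writes (t.filter (keepOn f)) = writes t := by
  induction t with
  | nil => rfl
  | cons e t ih =>
    rcases e with e | e
    · by_cases he : f e <;> simp_all [keepOn]
    · simp_all [keepOn, List.filter_cons]

theorem reads_filter_keepOn (f : In → Bool) (t : List (In ⊕ Out)) :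
    reads (t.filter (keepOn f)) = (reads t).filter f := by
  induction t with
  | nil => rfl
  | cons e t ih =>
    rcases e with e | e
    · by_cases he : f e <;> simp_all [keepOn]
    · simp_all [keepOn, List.filter_cons]

theorem length_eq_reads_add_writes (t : List (In ⊕ Out)) :
    t.length = (reads t).length + (writes t).length := by
  induction t with
  | nil => rfl
  | cons e t ih => cases e <;> simp_all <;> omega

end PDT

theorem filter_isNone_endmark {A : Type*} (w : List A) :
    (endmark w).filter Option.isNone = [none] := by
  simp [endmark, List.filter_map, Function.comp_def]

theorem sublist_endmark {A : Type*} {w : List A} {u : List (Option A)}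
    (h : u.Sublist (endmark w)) (hf : u.filter Option.isNone = [none]) :
    ∃ w' : List A, u = endmark w' := by
  obtain ⟨u₁, u₂, rfl, h₁, h₂⟩ := List.sublist_append_iff.1 h
  obtain ⟨w', -, rfl⟩ := List.sublist_map_iff.1 h₁
  refine ⟨w', ?_⟩
  rcases List.sublist_singleton.1 h₂ with rfl | rfl
  · simp [List.filter_map, Function.comp_def] at hf
  · rfl

namespace PDCE

open PDT

variable {A Γ Q : Type*}

theorem computes (C : PDCE A Γ Q) (w : List A) :
    C.Computes (endmark w) (C.finalState w) (C.output w) :=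
  (C.total w).choose_spec.choose_spec

theorem eq_of_pops {C : PDCE A Γ Q} {w t n p}
    (h : Pops C.Rule (.inl C.q₀) [C.z₀] t n p) (hr : reads t = endmark w) :
    p.elim id id = C.finalState w ∧ writes t = C.output w :=
  (hr ▸ computes_of_pops h : C.Computes (endmark w) _ _).unique (C.computes w)

/-- A shortest derivation of the run on `w#`. -/
theorem exists_minimal_pops (C : PDCE A Γ Q) (w : List A) :
    ∃ t n p, Pops C.Rule (.inl C.q₀) [C.z₀] t n p ∧ reads t = endmark w ∧
      ∀ t' n' p', Pops C.Rule (.inl C.q₀) [C.z₀] t' n' p' → reads t' = endmark w → n ≤ n' := by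
  classical
  have hex : ∃ n t p, Pops C.Rule (.inl C.q₀) [C.z₀] t n p ∧ reads t = endmark w := by
    obtain ⟨t, n, p, h, hr⟩ := (C.computes w).exists_pops
    exact ⟨n, t, p, h, hr⟩
  obtain ⟨t, p, h, hr⟩ := Nat.find_spec hex
  exact ⟨t, _, p, h, hr, fun t' n' p' h' hr' => Nat.find_min' hex ⟨t', p', h', hr'⟩⟩

/-- The output of a pushdown compressor is at most linearly long. -/
theorem exists_output_length_le [Finite A] [Fintype Γ] [Fintype Q] (C : PDCE A Γ Q) :
    ∃ c : ℕ, ∀ w, (C.output w).length ≤ c * (w.length + 1) := by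
  obtain ⟨L, hL⟩ := C.exists_rule_bound
  obtain ⟨c, hc⟩ := Pops.exists_length_le fun p z t p' v h => (hL p z t p' v h).2
  refine ⟨L * (2 * c), fun w => ?_⟩
  obtain ⟨t, n, p, h, hr, hmin⟩ := C.exists_minimal_pops w
  have hn := hc Sum.isLeft _ _ _ _ _ h fun t' n' h' _ hk => hmin t' n' p h' <| by
    rw [← reads_filter, hk, reads_filter, hr]
  rw [length_filter_isLeft, hr] at hn
  have ht := h.length_trace_le fun p z t p' v h => (hL p z t p' v h).1
  rw [length_eq_reads_add_writes, (eq_of_pops h hr).2] at ht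
  simp only [endmark, List.length_append, List.length_map, List.length_singleton] at hn
  calc (C.output w).length ≤ L * n := by omega
    _ ≤ L * (2 * c * (w.length + 1)) := by gcongr; nlinarith [Nat.zero_le (c * w.length)]
    _ = _ := by ring

/-- An information-lossless pushdown compressor with endmarker compresses every word at most by
a constant factor. -/
theorem IL.exists_le_output_length [Finite A] [Fintype Γ] [Fintype Q] {C : PDCE A Γ Q}
    (hIL : C.IL) :
    ∃ c : ℕ, ∀ w, w.length ≤ c * ((C.output w).length + 1) := by
  obtain ⟨L, hL⟩ := C.exists_rule_bound
  obtain ⟨c, hc⟩ := Pops.exists_length_le fun p z t p' v h => (hL p z t p' v h).2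
  refine ⟨L * (2 * c), fun w => ?_⟩
  obtain ⟨t, n, p, h, hr, hmin⟩ := C.exists_minimal_pops w
  have hn := hc (keepOn Option.isNone) _ _ _ _ _ h fun t' n' h' hs hk => by
    have hr' := congrArg reads hk
    rw [reads_filter_keepOn, reads_filter_keepOn, hr, filter_isNone_endmark] at hr'
    have hs' : (reads t').Sublist (reads t) := hs.filterMap _
    obtain ⟨w', hw'⟩ := sublist_endmark (hr ▸ hs') hr'
    have hwrites := congrArg writes hk
    rw [writes_filter_keepOn, writes_filter_keepOn] at hwrites
    have e := eq_of_pops h hr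
    have e' := eq_of_pops h' hw'
    have : w' = w := hIL (Prod.ext (by simp [← e.2, ← e'.2, hwrites]) (e'.1.symm.trans e.1))
    exact hmin t' n' p h' (this ▸ hw')
  rw [length_eq_reads_add_writes, reads_filter_keepOn, writes_filter_keepOn, hr,
    filter_isNone_endmark, (eq_of_pops h hr).2, List.length_singleton] at hn
  have ht := h.length_trace_le fun p z t p' v h => (hL p z t p' v h).1
  rw [length_eq_reads_add_writes, hr] at ht
  simp only [endmark, List.length_append, List.length_map] at ht
  calc w.length ≤ L * n := by omega
    _ ≤ L * (2 * c * ((C.output w).length + 1)) := by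
      gcongr; nlinarith [Nat.zero_le (c * (C.output w).length)]
    _ = _ := by ring

end PDCE

theorem liminf_div_pos {f : ℕ → ℕ} {c d : ℕ} (hc : ∀ n, n ≤ c * (f n + 1))
    (hd : ∀ n, f n ≤ d * (n + 1)) :
    0 < Filter.liminf (fun n : ℕ => (f n : ℝ) / n) Filter.atTop := by
  have hc0 : 0 < c := Nat.pos_of_ne_zero fun h => by simpa [h] using hc 1
  have hc0' : (0 : ℝ) < c := by exact_mod_cast hc0
  have hbdd : Filter.IsBoundedUnder (· ≤ ·) Filter.atTop fun n : ℕ => (f n : ℝ) / n := by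
    refine Filter.isBoundedUnder_of_eventually_le (a := 2 * (d : ℝ)) ?_
    filter_upwards [Filter.eventually_ge_atTop 1] with n hn
    have hn' : (1 : ℝ) ≤ n := by exact_mod_cast hn
    have h : (f n : ℝ) ≤ d * (n + 1) := by exact_mod_cast hd n
    rw [div_le_iff₀ (by linarith)]
    nlinarith [Nat.cast_nonneg (α := ℝ) d]
  refine lt_of_lt_of_le (b := 1 / (2 * (c : ℝ))) (by positivity)
    (Filter.le_liminf_of_le hbdd.isCoboundedUnder_ge ?_)
  filter_upwards [Filter.eventually_ge_atTop (2 * c)] with n hn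
  have hn' : 2 * (c : ℝ) ≤ n := by exact_mod_cast hn
  have h : (n : ℝ) ≤ c * (f n + 1) := by exact_mod_cast hc n
  rw [div_le_div_iff₀ (by positivity) (by linarith)]
  linarith

/-- Let `C` be an information-lossless pushdown compressor
over the binary alphabet, working with an endmarker.  Then `ρ_C(0^∞) > 0`,
i.e. `liminf_{n→∞} |C(0ⁿ#)|/n > 0`. -/
theorem ilpdce_zeros_ratio_pos {Γ Q : Type} [Fintype Γ] [Fintype Q]
    (C : PDCE Bool Γ Q) (hIL : C.IL) :
    0 < Filter.liminf
      (fun n : ℕ => ((C.output (List.replicate n false)).length : ℝ) / n)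
      Filter.atTop := by
  obtain ⟨c, hc⟩ := hIL.exists_le_output_length
  obtain ⟨d, hd⟩ := C.exists_output_length_le
  exact liminf_div_pos (fun n => by simpa using hc (List.replicate n false))
    fun n => by simpa using hd (List.replicate n false)
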